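/- arXiv:1006.2665 — 4 statements merged into one kernel-verified Lean document; each statement's English description precedes it below -/
import Mathlib

section
/- Let V be a real Banach space and let (v_k)_{k∈ℕ} be a weakly null sequence in V. Then for every ε > 0 there exist natural numbers k_0 < k_1 < … < k_j and nonnegative reals λ_0, …, λ_j with Σ_{i=0}^j λ_i = 1 such that max_{0≤i≤j} λ_i ≤ ε and, for every subset F ⊆ {0, …, j}, ‖Σ_{i∈F} λ_i v_{k_i}‖ ≤ ε. -/
open Filter

open MeasureTheory CompactlySupported in
/-- A positive linear functional on `C(X, ℝ)`, with `X` compact Hausdorff, sends uniformly bounded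
pointwise null sequences to null sequences. -/
theorem tendsto_positive_functional_of_bounded_pointwise {X : Type*} [TopologicalSpace X]
    [CompactSpace X] [T2Space X] (Λ : C(X, ℝ) →ₗ[ℝ] ℝ) (hΛ : ∀ h : C(X, ℝ), 0 ≤ h → 0 ≤ Λ h)
    (g : ℕ → C(X, ℝ)) (C : ℝ) (hC : ∀ k x, ‖g k x‖ ≤ C)
    (hg : ∀ x, Tendsto (fun k => g k x) atTop (nhds 0)) :
    Tendsto (fun k => Λ (g k)) atTop (nhds 0) := by
  borelize X
  let L : C_c(X, ℝ) →ₗ[ℝ] ℝ :=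
    { toFun := fun f => Λ (f : C(X, ℝ))
      map_add' := fun f h => Λ.map_add (f : C(X, ℝ)) h
      map_smul' := fun c f => Λ.map_smul c (f : C(X, ℝ)) }
  let P : C_c(X, ℝ) →ₚ[ℝ] ℝ := PositiveLinearMap.mk₀ L fun f hf => hΛ f fun x => hf x
  have hint (f : C(X, ℝ)) : ∫ x, f x ∂(RealRMK.rieszMeasure P) = Λ f :=
    RealRMK.integral_rieszMeasure P (CompactlySupportedContinuousMap.continuousMapEquiv f)
  simp_rw [← hint]
  rw [← integral_zero X ℝ (μ := RealRMK.rieszMeasure P)]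
  exact tendsto_integral_of_dominated_convergence (fun _ => C)
    (fun k => (g k).continuous.aestronglyMeasurable) (integrable_const C)
    (fun k => .of_forall (hC k)) (.of_forall hg)

theorem linearCombination_indicator_const {ι R E : Type*} [Semiring R] [AddCommMonoid E]
    [Module R E] (s : Finset ι) (a : R) (u : ι → E) :
    Finsupp.linearCombination R u (Finsupp.indicator s fun _ _ => a) = ∑ k ∈ s, a • u k := by
  rw [Finsupp.linearCombination_apply_of_mem_supported R (s := s)]
  · refine Finset.sum_congr rfl fun k hk => ?_
    rw [Finsupp.indicator_of_mem hk]
  · exact Finsupp.support_indicator_subset s _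

/-- Uniformly bounded, pointwise null sequences of continuous functions on a compact Hausdorff space
have uniformly small convex combinations with uniformly small weights. -/
theorem exists_convex_combination_lt {X : Type*} [TopologicalSpace X]
    [CompactSpace X] [T2Space X] (g : ℕ → C(X, ℝ)) (C : ℝ) (hC : ∀ k x, ‖g k x‖ ≤ C)
    (hg : ∀ x, Tendsto (fun k => g k x) atTop (nhds 0)) {ε : ℝ} (hε : 0 < ε) :
    ∃ w : ℕ →₀ ℝ, (∀ k, 0 ≤ w k) ∧ (∀ k, w k ≤ ε) ∧ ∑ k ∈ w.support, w k = 1 ∧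
      ∀ x, ∑ k ∈ w.support, w k * g k x < ε := by
  let W : Set (ℕ →₀ ℝ) :=
    {w | (∀ k, 0 ≤ w k) ∧ (∀ k, w k ≤ ε) ∧ Finsupp.linearCombination ℝ (fun _ => (1 : ℝ)) w = 1}
  let T : (ℕ →₀ ℝ) →ₗ[ℝ] C(X, ℝ) := Finsupp.linearCombination ℝ g
  let U : Set C(X, ℝ) := {h | ∀ x, h x < ε}
  have hW : Convex ℝ W := by
    rintro w ⟨hw0, hwε, hw1⟩ w' ⟨hw0', hwε', hw1'⟩ a b ha hb hab
    refine ⟨fun k => ?_, fun k => ?_, ?_⟩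
    · have := mul_nonneg ha (hw0 k)
      have := mul_nonneg hb (hw0' k)
      simp only [Finsupp.add_apply, Finsupp.smul_apply, smul_eq_mul]
      linarith
    · simp only [Finsupp.add_apply, Finsupp.smul_apply, smul_eq_mul]
      calc a * w k + b * w' k ≤ a * ε + b * ε := by gcongr; exacts [hwε k, hwε' k]
        _ = ε := by rw [← add_mul, hab, one_mul]
    · simp [hw1, hw1', hab]
  have hU : Convex ℝ U := by
    intro h hh h' hh' a b ha hb hab x
    exact convex_Iio ε (hh x) (hh' x) ha hb hab
  have hUo : IsOpen U := by
    simpa [U, Set.MapsTo] using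
      ContinuousMap.isOpen_setOfPred_mapsTo (X := X) (Y := ℝ) isCompact_univ (isOpen_Iio (a := ε))
  by_cases hdisj : Disjoint U (T '' W)
  · exfalso
    obtain ⟨Λ, c, hΛU, hΛW⟩ := geometric_hahn_banach_open hU hUo (hW.linear_image T) hdisj
    have hc : 0 < c := by simpa using hΛU 0 fun x => hε
    have hpos (h : C(X, ℝ)) (hh : 0 ≤ h) : 0 ≤ Λ h := by
      by_contra! hneg
      have ht : 0 ≤ c / -Λ h := by apply div_nonneg <;> linarith
      have := hΛU (-(c / -Λ h) • h) fun x => by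
        have : 0 ≤ c / -Λ h * h x := mul_nonneg ht (hh x)
        simp only [ContinuousMap.smul_apply, smul_eq_mul]
        linarith
      rw [map_smul, smul_eq_mul] at this
      have h2 : -(c / -Λ h) * Λ h = c := by field_simp [hneg.ne]
      linarith
    have hlim := tendsto_positive_functional_of_bounded_pointwise Λ.toLinearMap hpos g C hC hg
    obtain ⟨n, hn⟩ := eventually_atTop.1 (hlim.eventually_lt_const hc)
    obtain ⟨N, hN⟩ := exists_nat_gt (1 / ε)
    have hN0 : (0 : ℝ) < N := (by positivity : 0 < 1 / ε).trans hN
    have hNε : (N : ℝ)⁻¹ ≤ ε := by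
      rw [inv_le_comm₀ hN0 hε, ← one_div]
      exact hN.le
    let w : ℕ →₀ ℝ := Finsupp.indicator (Finset.Ico n (n + N)) fun _ _ => (N : ℝ)⁻¹
    have hw : w ∈ W := by
      refine ⟨fun k => ?_, fun k => ?_, ?_⟩
      · simp only [w, Finsupp.indicator_apply]
        split_ifs <;> positivity
      · simp only [w, Finsupp.indicator_apply]
        split_ifs
        exacts [hNε, hε.le]
      · simp [w, linearCombination_indicator_const, hN0.ne']
    have hge := hΛW (T w) ⟨w, hw, rfl⟩
    rw [show T w = _ from linearCombination_indicator_const _ _ g, map_sum] at hge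
    have hlt : ∑ k ∈ Finset.Ico n (n + N), Λ ((N : ℝ)⁻¹ • g k)
        < ∑ k ∈ Finset.Ico n (n + N), (N : ℝ)⁻¹ * c := by
      refine Finset.sum_lt_sum_of_nonempty ?_ fun k hk => ?_
      · simpa using hN0
      · rw [map_smul, smul_eq_mul]
        exact mul_lt_mul_of_pos_left (hn k (Finset.mem_Ico.1 hk).1) (by positivity)
    have hsum : ∑ k ∈ Finset.Ico n (n + N), (N : ℝ)⁻¹ * c = c := by simp [hN0.ne']
    linarith
  · obtain ⟨_, hTU, w, ⟨hw0, hwε, hw1⟩, rfl⟩ := Set.not_disjoint_iff.1 hdisj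
    refine ⟨w, hw0, hwε, ?_, fun x => ?_⟩
    · simpa [Finsupp.linearCombination_apply, Finsupp.sum] using hw1
    · simpa [T, Finsupp.linearCombination_apply, Finsupp.sum] using hTU x

/-- A weakly null sequence in a normed space is bounded. -/
theorem exists_norm_le_of_weakly_null {V : Type*} [NormedAddCommGroup V] [NormedSpace ℝ V]
    (v : ℕ → V) (hv : ∀ f : V →L[ℝ] ℝ, Tendsto (fun k => f (v k)) atTop (nhds 0)) :
    ∃ C, ∀ k, ‖v k‖ ≤ C := by
  obtain ⟨C, hC⟩ := banach_steinhaus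
    (g := fun k => NormedSpace.inclusionInDoubleDualLi (E := V) ℝ (v k)) fun f => by
      obtain ⟨C, hC⟩ := (Metric.isBounded_range_of_tendsto _ (hv f)).exists_norm_le
      exact ⟨C, fun k => hC _ ⟨k, rfl⟩⟩
  exact ⟨C, fun k => (LinearIsometry.norm_map _ (v k)).symm.trans_le (hC k)⟩

/-- Let `V` be a real Banach space and `(v k)` a weakly null
sequence in `V`.  Then for every `ε > 0` there exist `k₀ < k₁ < … < k_j` and
nonnegative reals `λ₀, …, λ_j` summing to `1`, each `≤ ε`, such that
`‖∑_{i ∈ F} λ_i v_{k_i}‖ ≤ ε` for every `F ⊆ {0, …, j}`. -/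
theorem stmt_0 {V : Type*} [NormedAddCommGroup V] [NormedSpace ℝ V] [CompleteSpace V]
    (v : ℕ → V)
    (hv : ∀ f : V →L[ℝ] ℝ, Tendsto (fun k => f (v k)) atTop (nhds 0)) :
    ∀ ε : ℝ, 0 < ε →
      ∃ (j : ℕ) (k : Fin (j + 1) → ℕ) (lam : Fin (j + 1) → ℝ),
        StrictMono k ∧ (∀ i, 0 ≤ lam i) ∧ (∑ i, lam i = 1) ∧
        (∀ i, lam i ≤ ε) ∧
        ∀ F : Finset (Fin (j + 1)), ‖∑ i ∈ F, lam i • v (k i)‖ ≤ ε := by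
  intro ε hε
  let B : Set (WeakDual ℝ V) := WeakDual.toStrongDual ⁻¹' Metric.closedBall 0 1
  have : CompactSpace B := isCompact_iff_compactSpace.1 (WeakDual.isCompact_closedBall 0 1)
  let g (k : ℕ) : C(B, ℝ) :=
    ⟨fun f => |f.1 (v k)|, ((WeakDual.eval_continuous (v k)).comp continuous_subtype_val).abs⟩
  obtain ⟨C, hC⟩ := exists_norm_le_of_weakly_null v hv
  obtain ⟨w, hw0, hwε, hw1, hw⟩ := exists_convex_combination_lt g C
    (fun k f => by
      have hf : ‖WeakDual.toStrongDual f.1‖ ≤ 1 := mem_closedBall_zero_iff.1 f.2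
      have h : ‖f.1 (v k)‖ ≤ 1 * ‖v k‖ := (WeakDual.toStrongDual f.1).le_of_opNorm_le hf (v k)
      rw [one_mul] at h
      simpa [g] using h.trans (hC k))
    (fun f => by simpa [g] using (hv (WeakDual.toStrongDual f.1)).abs) hε
  have hcard : w.support.card = (w.support.card - 1) + 1 := by
    refine (Nat.sub_add_cancel (Finset.card_pos.2 ?_)).symm
    exact Finset.nonempty_of_sum_ne_zero (hw1.trans_ne one_ne_zero)
  let e := w.support.orderEmbOfFin hcard
  have hsum (u : ℕ → ℝ) : ∑ i, u (e i) = ∑ k ∈ w.support, u k := by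
    have h := Finset.sum_map Finset.univ e.toEmbedding u
    rw [Finset.map_orderEmbOfFin_univ] at h
    exact h.symm
  refine ⟨_, e, fun i => w (e i), e.strictMono, fun i => hw0 _, (hsum w).trans hw1,
    fun i => hwε _, fun F => ?_⟩
  obtain ⟨f, hf, hfv⟩ := exists_dual_vector'' ℝ (∑ i ∈ F, w (e i) • v (e i))
  have hfB : StrongDual.toWeakDual f ∈ B := by simpa [B] using hf
  calc ‖∑ i ∈ F, w (e i) • v (e i)‖ = ∑ i ∈ F, w (e i) * f (v (e i)) := by
        simpa using hfv.symm
    _ ≤ ∑ i ∈ F, w (e i) * |f (v (e i))| := by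
        gcongr with i
        exacts [hw0 _, le_abs_self _]
    _ ≤ ∑ i, w (e i) * |f (v (e i))| :=
        Finset.sum_le_sum_of_subset_of_nonneg (Finset.subset_univ F)
          fun i _ _ => mul_nonneg (hw0 _) (abs_nonneg _)
    _ = ∑ k ∈ w.support, w k * |f (v k)| := hsum fun k => w k * |f (v k)|
    _ ≤ ε := (hw ⟨_, hfB⟩).le
end

section
/- Let (v_k)_{k∈ℕ} be a block sequence of (e_n) which is bounded in the norm ‖·‖_E. If the sequence (Q_X(v_k))_{k∈ℕ} is weakly null in X, then (v_k) is weakly null in E_X, i.e. f(v_k) → 0 for every continuous linear functional f on E_X. -/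
open Filter

section

variable {X : Type*} [NormedAddCommGroup X] [NormedSpace ℝ X]

/-- The partial sums of a finitely supported series of vectors are bounded in norm. -/
lemma bddAbove_norm_partialSum (x : ℕ → X) (z : ℕ →₀ ℝ) :
    BddAbove (Set.range fun m : ℕ => ‖∑ n ∈ Finset.range (m + 1), z n • x n‖) := by
  refine ⟨∑ n ∈ z.support, ‖z n • x n‖, ?_⟩
  rintro _ ⟨m, rfl⟩
  refine (norm_sum_le _ _).trans ?_
  rw [← Finset.sum_filter_ne_zero]
  refine Finset.sum_le_sum_of_subset_of_nonneg (fun n hn => ?_) fun _ _ _ => norm_nonneg _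
  rw [Finsupp.mem_support_iff]
  rintro h
  simp [h] at hn

/-- A partial sum that covers the support equals the full linear combination. -/
lemma sum_range_eq_linearCombination (x : ℕ → X) (z : ℕ →₀ ℝ) {N m : ℕ}
    (hz : ∀ n, N ≤ n → z n = 0) (hm : N ≤ m) :
    ∑ n ∈ Finset.range m, z n • x n = Finsupp.linearCombination ℝ x z := by
  rw [Finsupp.linearCombination_apply, Finsupp.sum_of_support_subset z (s := Finset.range m) _
    (fun n a => a • x n) fun _ _ => zero_smul ℝ _]
  intro n hn
  rw [Finset.mem_range]
  by_contra! h
  exact Finsupp.mem_support_iff.1 hn (hz n (hm.trans h))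

/-- Supports of a block sequence move to the right at least as fast as the index. -/
lemma le_of_mem_support_block {v : ℕ → (ℕ →₀ ℝ)} (hv0 : ∀ k, v k ≠ 0)
    (hblock : ∀ k, ∀ i ∈ (v k).support, ∀ j ∈ (v (k + 1)).support, i < j) :
    ∀ k, ∀ i ∈ (v k).support, k ≤ i := by
  intro k
  induction k with
  | zero => exact fun i _ => i.zero_le
  | succ k ih =>
    intro i hi
    obtain ⟨j, hj⟩ := Finsupp.support_nonempty_iff.2 (hv0 k)
    exact (ih j hj).trans_lt (hblock k j hj i hi)

/-- Mazur's lemma along a frequently recurring set of indices: if `T (v k)` is weakly null, then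
convex combinations of the far-out `v k` with `p k` have arbitrarily small image. -/
lemma exists_mem_convexHull_norm_lt {V : Type*} [AddCommGroup V] [Module ℝ V] (T : V →ₗ[ℝ] X)
    {v : ℕ → V} (hwn : ∀ f : X →L[ℝ] ℝ, Tendsto (fun k => f (T (v k))) atTop (nhds 0))
    {p : ℕ → Prop} (hp : ∃ᶠ k in atTop, p k) (N : ℕ) {ε : ℝ} (hε : 0 < ε) :
    ∃ z ∈ convexHull ℝ (v '' {k | N ≤ k ∧ p k}), ‖T z‖ < ε := by
  have h0 : (0 : X) ∈ closure (T '' convexHull ℝ (v '' {k | N ≤ k ∧ p k})) := by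
    by_contra h
    obtain ⟨f, u, hf, hu⟩ := geometric_hahn_banach_closed_point
      ((convex_convexHull ℝ _).linear_image T).closure isClosed_closure h
    rw [map_zero] at hu
    obtain ⟨k, hpk, hNk, hk⟩ := (hp.and_eventually
      ((eventually_ge_atTop N).and ((hwn f).eventually (lt_mem_nhds hu)))).exists
    exact (hf _ (subset_closure (Set.mem_image_of_mem T
      (subset_convexHull ℝ _ (Set.mem_image_of_mem v ⟨hNk, hpk⟩))))).not_gt hk
  obtain ⟨_, ⟨z, hz, rfl⟩, hlt⟩ := Metric.mem_closure_iff.1 h0 ε hε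
  exact ⟨z, hz, by simpa using hlt⟩

variable {E : Type*} [NormedAddCommGroup E] [NormedSpace ℝ E]

/-- If `w` vanishes from `N` on and `z` vanishes before `N`, the norm of `w + z` is controlled by
the norm of `w`, the sum of the series of `w`, and the norm of `z`. -/
lemma norm_add_le_of_disjoint {x : ℕ → X} {ι : (ℕ →₀ ℝ) →ₗ[ℝ] E}
    (hnorm : ∀ z : ℕ →₀ ℝ, ‖ι z‖ = ⨆ m : ℕ, ‖∑ n ∈ Finset.range (m + 1), z n • x n‖)
    {w z : ℕ →₀ ℝ} {N : ℕ} (hw : ∀ n, N ≤ n → w n = 0) (hz : ∀ n, n < N → z n = 0) :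
    ‖ι (w + z)‖ ≤ max ‖ι w‖ (‖Finsupp.linearCombination ℝ x w‖ + ‖ι z‖) := by
  have hle : ∀ (y : ℕ →₀ ℝ) (m : ℕ), ‖∑ n ∈ Finset.range (m + 1), y n • x n‖ ≤ ‖ι y‖ :=
    fun y m => (le_ciSup (bddAbove_norm_partialSum x y) m).trans_eq (hnorm y).symm
  rw [hnorm (w + z)]
  refine ciSup_le fun m => ?_
  simp only [Finsupp.add_apply, add_smul, Finset.sum_add_distrib]
  rcases le_or_gt N (m + 1) with h | h
  · rw [sum_range_eq_linearCombination x w hw h]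
    exact ((norm_add_le _ _).trans (add_le_add_right (hle z m) _)).trans (le_max_right _ _)
  · rw [Finset.sum_eq_zero (s := Finset.range (m + 1)) (f := fun n => z n • x n), add_zero]
    · exact (hle w m).trans (le_max_left _ _)
    · intro n hn
      rw [hz n ((Finset.mem_range.1 hn).trans h), zero_smul]

/-- A functional is eventually small from above on a bounded block sequence whose sums are
weakly null. -/
lemma eventually_lt_of_block {x : ℕ → X} {ι : (ℕ →₀ ℝ) →ₗ[ℝ] E}
    (hnorm : ∀ z : ℕ →₀ ℝ, ‖ι z‖ = ⨆ m : ℕ, ‖∑ n ∈ Finset.range (m + 1), z n • x n‖)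
    {v : ℕ → (ℕ →₀ ℝ)} (hv : ∀ k, ∀ i ∈ (v k).support, k ≤ i)
    {C : ℝ} (hC : ∀ k, ‖ι (v k)‖ ≤ C)
    (hwn : ∀ f : X →L[ℝ] ℝ,
      Tendsto (fun k => f (Finsupp.linearCombination ℝ x (v k))) atTop (nhds 0))
    (g : E →L[ℝ] ℝ) {δ : ℝ} (hδ : 0 < δ) : ∀ᶠ k in atTop, g (ι (v k)) < δ := by
  by_contra hfreq
  have hfreq' : ∃ᶠ k in atTop, δ ≤ g (ι (v k)) := by
    simpa only [not_eventually, not_lt] using hfreq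
  have hfar : ∀ (N : ℕ) {ε : ℝ}, 0 < ε → ∃ z : ℕ →₀ ℝ, (∀ n, n < N → z n = 0) ∧
      ‖ι z‖ ≤ C ∧ δ ≤ g (ι z) ∧ ‖Finsupp.linearCombination ℝ x z‖ < ε := by
    intro N ε hε
    obtain ⟨z, hz, hzε⟩ := exists_mem_convexHull_norm_lt _ hwn hfreq' N hε
    have hvanish : Convex ℝ {z : ℕ →₀ ℝ | ∀ n, n < N → z n = 0} := by
      intro a ha b hb s t _ _ _ n hn
      simp [ha n hn, hb n hn]
    have hball : Convex ℝ {z : ℕ →₀ ℝ | ‖ι z‖ ≤ C} := by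
      simpa [Set.preimage] using (convex_closedBall (0 : E) C).linear_preimage ι
    have hhalf : Convex ℝ {z : ℕ →₀ ℝ | δ ≤ g (ι z)} :=
      (convex_Ici δ).linear_preimage (g.toLinearMap ∘ₗ ι)
    have hsub := convexHull_min (s := v '' {k | N ≤ k ∧ δ ≤ g (ι (v k))}) (by
      rintro _ ⟨k, ⟨hNk, hk⟩, rfl⟩
      refine ⟨fun n hn => ?_, hC k, hk⟩
      by_contra h
      exact (hv k n (Finsupp.mem_support_iff.2 h)).not_gt (hn.trans_le hNk))
      (hvanish.inter (hball.inter hhalf)) hz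
    exact ⟨z, hsub.1, hsub.2.1, hsub.2.2, hzε⟩
  have hC0 : 0 ≤ C := (norm_nonneg _).trans (hC 0)
  have hsum : ∀ j : ℕ, ∃ w : ℕ →₀ ℝ, ‖ι w‖ ≤ 1 + C ∧
      ‖Finsupp.linearCombination ℝ x w‖ < 1 ∧ j * δ ≤ g (ι w) := by
    intro j
    induction j with
    | zero => exact ⟨0, by simp; positivity, by simp, by simp⟩
    | succ j ih =>
      obtain ⟨w, hw, hw1, hwg⟩ := ih
      obtain ⟨z, hz0, hz, hzg, hz1⟩ := hfar (w.support.sup id + 1) (sub_pos.2 hw1)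
      refine ⟨w + z, ?_, ?_, ?_⟩
      · refine (norm_add_le_of_disjoint hnorm (fun n hn => ?_) hz0).trans
          (max_le hw (add_le_add hw1.le hz))
        by_contra h
        exact (Finset.le_sup (f := id) (Finsupp.mem_support_iff.2 h)).not_gt hn
      · rw [map_add]
        linarith [norm_add_le (Finsupp.linearCombination ℝ x w) (Finsupp.linearCombination ℝ x z)]
      · rw [map_add, map_add]
        push_cast
        linarith
  obtain ⟨j, hj⟩ := exists_nat_gt (‖g‖ * (1 + C) / δ)
  obtain ⟨w, hw, -, hwg⟩ := hsum j
  rw [div_lt_iff₀ hδ] at hj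
  have hgw : g (ι w) ≤ ‖g‖ * (1 + C) :=
    (le_abs_self _).trans ((g.le_opNorm _).trans (by gcongr))
  linarith

end

/-- In the space `E_X`: if `(v k)` is a bounded block sequence
of `(e n)` and `(Q (v k))` is weakly null in `X`, then `(v k)` is weakly null
in `E_X`. -/
theorem stmt_3 {X : Type*} [NormedAddCommGroup X] [NormedSpace ℝ X] [CompleteSpace X]
    (x : ℕ → X) (hx1 : ∀ n, ‖x n‖ = 1)
    (hxd : ∀ y : X, ‖y‖ = 1 → ∀ ε : ℝ, 0 < ε → ∃ n, ‖y - x n‖ < ε)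
    {E : Type*} [NormedAddCommGroup E] [NormedSpace ℝ E] [CompleteSpace E]
    (ι : (ℕ →₀ ℝ) →ₗ[ℝ] E) (hιd : DenseRange ι)
    (hnorm : ∀ z : ℕ →₀ ℝ,
      ‖ι z‖ = ⨆ m : ℕ, ‖∑ n ∈ Finset.range (m + 1), z n • x n‖)
    (Q : E →L[ℝ] X) (hQ : ∀ n, Q (ι (Finsupp.single n 1)) = x n)
    -- `(v k)` is a block sequence of `(e n)`
    (v : ℕ → (ℕ →₀ ℝ)) (hv0 : ∀ k, v k ≠ 0)
    (hblock : ∀ k, ∀ i ∈ (v k).support, ∀ j ∈ (v (k + 1)).support, i < j)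
    -- bounded in `‖·‖_E`
    (C : ℝ) (hC : ∀ k, ‖ι (v k)‖ ≤ C)
    -- `(Q (v k))` is weakly null in `X`
    (hwn : ∀ f : X →L[ℝ] ℝ, Tendsto (fun k => f (Q (ι (v k)))) atTop (nhds 0)) :
    -- `(v k)` is weakly null in `E_X`
    ∀ g : E →L[ℝ] ℝ, Tendsto (fun k => g (ι (v k))) atTop (nhds 0) := by
  intro g
  have hQι : ∀ z, Q (ι z) = Finsupp.linearCombination ℝ x z := by
    have h : Q.toLinearMap ∘ₗ ι = Finsupp.linearCombination ℝ x :=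
      Finsupp.lhom_ext' fun n => LinearMap.ext_ring (by simp [hQ])
    exact fun z => LinearMap.congr_fun h z
  simp only [hQι] at hwn
  have hv := le_of_mem_support_block hv0 hblock
  rw [Metric.tendsto_nhds]
  intro δ hδ
  filter_upwards [eventually_lt_of_block hnorm hv hC hwn g hδ,
    eventually_lt_of_block hnorm hv hC hwn (-g) hδ] with k hk hk'
  rw [Real.dist_0_eq_abs, abs_lt]
  rw [neg_apply] at hk'
  exact ⟨by linarith, hk⟩
end

section
/- Let Z be an infinite-dimensional real Banach space which is minimal (i.e. every infinite-dimensional closed subspace of Z contains an isomorphic copy of Z) and which does not contain an isomorphic copy of c₀. If X does not contain an isomorphic copy of Z, then E_X does not contain an isomorphic copy of Z. -/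
open ZeroAtInfty

open Filter Topology in
theorem exists_embedding_zeroAtInfty_of_almost_bounds
    {Z : Type*} [NormedAddCommGroup Z] [NormedSpace ℝ Z] [CompleteSpace Z]
    (z : ℕ → Z) {C d : ℝ} (hd : 0 < d)
    (hup : ∀ (s : Finset ℕ) (a : ℕ → ℝ) (M : ℝ), 0 ≤ M → (∀ j ∈ s, |a j| ≤ M) →
      ‖∑ j ∈ s, a j • z j‖ ≤ C * M)
    (hlow : ∀ (s : Finset ℕ) (a : ℕ → ℝ) (M : ℝ), 0 ≤ M → (∀ j ∈ s, |a j| ≤ M) →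
      ∀ k ∈ s, d * |a k| ≤ ‖∑ j ∈ s, a j • z j‖ + d / 2 * M) :
    ∃ T : C₀(ℕ, ℝ) →L[ℝ] Z, ∃ c : ℝ, 0 < c ∧ ∀ f : C₀(ℕ, ℝ), c * ‖f‖ ≤ ‖T f‖ := by
  have hC : 0 ≤ C := by simpa using hup ∅ 0 1 zero_le_one (by simp)
  have hcoord (f : C₀(ℕ, ℝ)) (j : ℕ) : |f j| ≤ ‖f‖ := by
    simpa using f.toBCF.norm_coe_le_norm j
  have hsum (f : C₀(ℕ, ℝ)) : Summable fun j ↦ f j • z j := by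
    rw [summable_iff_vanishing_norm]
    intro ε hε
    have hη : 0 < ε / (C + 1) := by positivity
    have hf : ∀ᶠ j in cofinite, |f j| < ε / (C + 1) := by
      have h := f.zero_at_infty'
      rw [cocompact_eq_cofinite] at h
      simpa using h.eventually (Metric.ball_mem_nhds (0 : ℝ) hη)
    rw [eventually_cofinite] at hf
    refine ⟨hf.toFinset, fun t ht ↦ ?_⟩
    refine (hup t f _ hη.le fun j hj ↦ ?_).trans_lt ?_
    · by_contra! h
      exact Finset.disjoint_left.1 ht hj (hf.mem_toFinset.2 h.le.not_gt)
    · rw [← mul_div_assoc, div_lt_iff₀ (by positivity)]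
      nlinarith
  let L : C₀(ℕ, ℝ) →ₗ[ℝ] Z :=
    { toFun f := ∑' j, f j • z j
      map_add' f g := by simp [add_smul, (hsum f).tsum_add (hsum g)]
      map_smul' r f := by simp [mul_smul, (hsum f).tsum_const_smul r] }
  have hL (f : C₀(ℕ, ℝ)) : HasSum (fun j ↦ f j • z j) (L f) := (hsum f).hasSum
  refine ⟨L.mkContinuous C fun f ↦ ?_, d / 2, by positivity, fun f ↦ ?_⟩
  · exact le_of_tendsto (hL f).norm
      (Eventually.of_forall fun s ↦ hup s f _ (norm_nonneg f) fun j _ ↦ hcoord f j)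
  · have hk (k : ℕ) : d * |f k| ≤ ‖L f‖ + d / 2 * ‖f‖ := by
      refine ge_of_tendsto ((hL f).norm.add_const (d / 2 * ‖f‖)) ?_
      filter_upwards [eventually_ge_atTop {k}] with s hs
      exact hlow s f _ (norm_nonneg f) (fun j _ ↦ hcoord f j) k (hs (Finset.mem_singleton_self k))
    have hf : ‖f‖ ≤ (‖L f‖ + d / 2 * ‖f‖) / d := by
      rw [← ZeroAtInftyContinuousMap.norm_toBCF_eq_norm,
        BoundedContinuousFunction.norm_le (by positivity)]
      intro k
      rw [ZeroAtInftyContinuousMap.norm_toBCF_eq_norm, le_div_iff₀ hd, mul_comm]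
      exact hk k
    rw [le_div_iff₀ hd] at hf
    change d / 2 * ‖f‖ ≤ ‖L f‖
    linarith

theorem exists_embedding_zeroAtInfty_of_gliding_hump
    {X Z : Type*} [NormedAddCommGroup X] [NormedSpace ℝ X]
    [NormedAddCommGroup Z] [NormedSpace ℝ Z] [CompleteSpace Z]
    (A : ℕ → Z →L[ℝ] X) {c D : ℝ} (hc : 0 < c) (hD : 0 < D)
    (hA : ∀ m z, ‖A m z‖ ≤ D * ‖z‖) (hA' : ∀ z, ∃ m, c * ‖z‖ ≤ ‖A m z‖)
    (hstep : ∀ (n : ℕ) (ε : ℝ), 0 < ε → ∃ z, ‖z‖ = 1 ∧ (∀ m < n, A m z = 0) ∧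
      ∃ n' > n, ∀ m ≥ n', ‖A m z‖ ≤ ε) :
    ∃ T : C₀(ℕ, ℝ) →L[ℝ] Z, ∃ c : ℝ, 0 < c ∧ ∀ f : C₀(ℕ, ℝ), c * ‖f‖ ≤ ‖T f‖ := by
  have hc4 : 0 < c / 4 := by positivity
  obtain ⟨ε, hε, σ, hεσ, hσ⟩ := posSumOfEncodable hc4 ℕ
  have hεsum (s : Finset ℕ) : ∑ j ∈ s, ε j ≤ c / 4 :=
    (sum_le_hasSum s (fun j _ ↦ (hε j).le) hεσ).trans hσ
  have hεlt (k : ℕ) : ε k < c := by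
    have := hεsum {k}
    rw [Finset.sum_singleton] at this
    linarith
  choose f hf1 hf0 g hg hfg using fun n k ↦ hstep n (ε k) (hε k)
  let n : ℕ → ℕ := fun k ↦ Nat.rec (motive := fun _ ↦ ℕ) 0 (fun k n ↦ g n k) k
  have hmono : StrictMono n := strictMono_nat_of_lt_succ fun k ↦ hg (n k) k
  let z : ℕ → Z := fun k ↦ f (n k) k
  have hz (k : ℕ) : ‖z k‖ = 1 := hf1 _ _
  have hoff (m j : ℕ) (h : m < n j ∨ n (j + 1) ≤ m) : ‖A m (z j)‖ ≤ ε j := by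
    rcases h with h | h
    · rw [hf0 _ _ m h, norm_zero]
      exact (hε j).le
    · exact hfg _ _ m h
  have hwin (m : ℕ) : ∃ k, ∀ j ≠ k, ‖A m (z j)‖ ≤ ε j := by
    by_cases h : ∃ k, n k ≤ m ∧ m < n (k + 1)
    · obtain ⟨k, hk1, hk2⟩ := h
      refine ⟨k, fun j hj ↦ hoff m j ?_⟩
      rcases lt_or_gt_of_ne hj with hj | hj
      · exact Or.inr ((hmono.monotone hj).trans hk1)
      · exact Or.inl (hk2.trans_le (hmono.monotone hj))
    · push Not at h
      refine ⟨0, fun j _ ↦ hoff m j ?_⟩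
      rcases lt_or_ge m (n j) with h' | h'
      · exact Or.inl h'
      · exact Or.inr (h j h')
  have hterm (m : ℕ) (a : ℕ → ℝ) (j : ℕ) : ‖A m (a j • z j)‖ = |a j| * ‖A m (z j)‖ := by
    rw [map_smul, norm_smul, Real.norm_eq_abs]
  have hrest (m k : ℕ) (hk : ∀ j ≠ k, ‖A m (z j)‖ ≤ ε j) (s : Finset ℕ) (a : ℕ → ℝ) (M : ℝ)
      (hM : 0 ≤ M) (ha : ∀ j ∈ s, |a j| ≤ M) :
      ‖∑ j ∈ s.erase k, A m (a j • z j)‖ ≤ c / 4 * M := calc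
    _ ≤ ∑ j ∈ s.erase k, ε j * M := by
      refine norm_sum_le_of_le _ fun j hj ↦ ?_
      rw [hterm, mul_comm]
      exact mul_le_mul (hk j (Finset.ne_of_mem_erase hj)) (ha j (Finset.mem_of_mem_erase hj))
        (abs_nonneg _) (hε j).le
    _ ≤ c / 4 * M := by
      rw [← Finset.sum_mul]
      exact mul_le_mul_of_nonneg_right (hεsum _) hM
  refine exists_embedding_zeroAtInfty_of_almost_bounds z (C := (c / 4 + D) / c) (d := c / D)
    (by positivity) (fun s a M hM ha ↦ ?_) (fun s a M hM ha k hk ↦ ?_)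
  · obtain ⟨m, hm⟩ := hA' (∑ j ∈ s, a j • z j)
    obtain ⟨k, hk⟩ := hwin m
    have h : ‖A m (∑ j ∈ s, a j • z j)‖ ≤ (c / 4 + D) * M := by
      rw [map_sum]
      have hr := hrest m k hk s a M hM ha
      by_cases hks : k ∈ s
      · rw [← Finset.add_sum_erase _ _ hks]
        refine (norm_add_le _ _).trans ?_
        have : ‖A m (a k • z k)‖ ≤ M * D := by
          rw [hterm]
          refine mul_le_mul (ha k hks) ?_ (norm_nonneg _) hM
          simpa [hz] using hA m (z k)
        linarith
      · rw [Finset.erase_eq_of_notMem hks] at hr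
        nlinarith
    rw [div_mul_eq_mul_div, le_div_iff₀ hc, mul_comm]
    exact hm.trans h
  · obtain ⟨m, hm⟩ := hA' (z k)
    rw [hz, mul_one] at hm
    obtain ⟨k', hk'⟩ := hwin m
    obtain rfl : k = k' := by
      by_contra hne
      exact absurd (hm.trans (hk' k hne)) (hεlt k).not_ge
    have hr := hrest m k hk' s a M hM ha
    have hD' := hA m (∑ j ∈ s, a j • z j)
    rw [map_sum, ← Finset.add_sum_erase _ _ hk] at hD'
    have h1 := norm_sub_le_norm_add (A m (a k • z k)) (∑ j ∈ s.erase k, A m (a j • z j))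
    rw [hterm] at h1
    have h2 : |a k| * c ≤ |a k| * ‖A m (z k)‖ := mul_le_mul_of_nonneg_left hm (abs_nonneg _)
    have h3 : c * |a k| ≤ D * ‖∑ j ∈ s, a j • z j‖ + c / 2 * M := by
      nlinarith [mul_nonneg hc.le hM]
    calc c / D * |a k| = c * |a k| / D := by ring
      _ ≤ (D * ‖∑ j ∈ s, a j • z j‖ + c / 2 * M) / D := by gcongr
      _ = _ := by field_simp

open Filter Topology in
theorem exists_embedding_zeroAtInfty_of_finiteRank_approx
    {X Z : Type*} [NormedAddCommGroup X] [NormedSpace ℝ X]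
    [NormedAddCommGroup Z] [NormedSpace ℝ Z] [CompleteSpace Z]
    (hZinf : ¬ FiniteDimensional ℝ Z)
    (A : ℕ → Z →L[ℝ] X) (B : Z →L[ℝ] X) {c D : ℝ} (hc : 0 < c) (hD : 0 < D)
    (hA : ∀ m z, ‖A m z‖ ≤ D * ‖z‖) (hA' : ∀ z, ∃ m, c * ‖z‖ ≤ ‖A m z‖)
    (hfin : ∀ m, (A m : Z →ₗ[ℝ] X).range.FG)
    (hlim : ∀ z, Tendsto (fun m ↦ A m z) atTop (𝓝 (B z)))
    (hB : ∀ W : Submodule ℝ Z, IsClosed (W : Set Z) → ¬ FiniteDimensional ℝ W →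
      ¬ ∃ ε : ℝ, 0 < ε ∧ ∀ z ∈ W, ε * ‖z‖ ≤ ‖B z‖) :
    ∃ T : C₀(ℕ, ℝ) →L[ℝ] Z, ∃ c : ℝ, 0 < c ∧ ∀ f : C₀(ℕ, ℝ), c * ‖f‖ ≤ ‖T f‖ := by
  refine exists_embedding_zeroAtInfty_of_gliding_hump A hc hD hA hA' fun n ε hε ↦ ?_
  let W : Submodule ℝ Z := ⨅ i : Fin n, (A i : Z →ₗ[ℝ] X).ker
  have hWcofg : W.CoFG := by
    refine Submodule.CoFG.sInf_of_finite (Set.finite_range _) ?_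
    rintro _ ⟨i, rfl⟩
    exact Submodule.range_fg_iff_ker_cofg.1 (hfin i)
  have hWclosed : IsClosed (W : Set Z) := by
    simp only [W, Submodule.coe_iInf]
    exact isClosed_iInter fun i ↦ (A i).isClosed_ker
  have hWinf : ¬ FiniteDimensional ℝ W := fun h ↦ by
    have : Module.Finite ℝ (Z ⧸ W) := hWcofg
    exact hZinf (Module.Finite.of_submodule_quotient W)
  have hex := hB W hWclosed hWinf
  push Not at hex
  obtain ⟨w, hwW, hw⟩ := hex (ε / 2) (by positivity)
  have hw0 : 0 < ‖w‖ := by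
    rw [norm_pos_iff]
    rintro rfl
    simp at hw
  refine ⟨‖w‖⁻¹ • w, ?_, fun m hm ↦ ?_, ?_⟩
  · simp [norm_smul, hw0.ne']
  · have := (Submodule.mem_iInf _).1 hwW ⟨m, hm⟩
    rw [map_smul, show A m w = 0 from this, smul_zero]
  · have hlt : ‖B (‖w‖⁻¹ • w)‖ < ε := by
      rw [map_smul, norm_smul, norm_inv, norm_norm, inv_mul_lt_iff₀ hw0]
      nlinarith
    obtain ⟨N, hN⟩ := eventually_atTop.1 ((hlim (‖w‖⁻¹ • w)).norm.eventually_lt_const hlt)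
    exact ⟨max N (n + 1), lt_max_of_lt_right (Nat.lt_succ_self n),
      fun m hm ↦ (hN m (le_of_max_le_left hm)).le⟩

open Filter Topology in
/-- The partial sum operators of a space normed by suprema of partial sums. -/
theorem exists_partialSum_operators {X : Type*} [NormedAddCommGroup X] [NormedSpace ℝ X]
    [CompleteSpace X] (x : ℕ → X)
    {E : Type*} [NormedAddCommGroup E] [NormedSpace ℝ E]
    (ι : (ℕ →₀ ℝ) →ₗ[ℝ] E) (hιd : DenseRange ι)
    (hnorm : ∀ z : ℕ →₀ ℝ,
      ‖ι z‖ = ⨆ m : ℕ, ‖∑ n ∈ Finset.range (m + 1), z n • x n‖) :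
    ∃ (S : ℕ → E →L[ℝ] X) (Q : E →L[ℝ] X), (∀ m y, ‖S m y‖ ≤ ‖y‖) ∧
      (∀ y, ∃ m, ‖y‖ / 2 ≤ ‖S m y‖) ∧ (∀ m, (S m : E →ₗ[ℝ] X).range.FG) ∧
      ∀ y, Tendsto (fun m ↦ S m y) atTop (𝓝 (Q y)) := by
  let s (m : ℕ) : (ℕ →₀ ℝ) →ₗ[ℝ] X :=
    ∑ n ∈ Finset.range (m + 1), (Finsupp.lapply n).smulRight (x n)
  have hs (m : ℕ) (z : ℕ →₀ ℝ) : s m z = ∑ n ∈ Finset.range (m + 1), z n • x n := by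
    simp [s]
  let q : (ℕ →₀ ℝ) →ₗ[ℝ] X := Finsupp.linearCombination ℝ x
  have hq (z : ℕ →₀ ℝ) : ∃ N, ∀ m ≥ N, s m z = q z := by
    obtain ⟨N, hN⟩ := z.support.exists_nat_subset_range
    refine ⟨N, fun m hm ↦ ?_⟩
    rw [hs, Finsupp.linearCombination_apply, Finsupp.sum_of_support_subset z
      (hN.trans (Finset.range_mono (Nat.le_succ_of_le hm))) _ (by simp)]
  have hbdd (z : ℕ →₀ ℝ) : BddAbove (Set.range fun m ↦ ‖s m z‖) := by
    obtain ⟨N, hN⟩ := hq z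
    refine (tendsto_atTop_of_eventually_const (x := ‖q z‖) (i₀ := N) ?_).bddAbove_range
    intro m hm
    rw [hN m hm]
  have hι (z : ℕ →₀ ℝ) : ‖ι z‖ = ⨆ m : ℕ, ‖s m z‖ := by simp only [hnorm, hs]
  have hsle (m : ℕ) (z : ℕ →₀ ℝ) : ‖s m z‖ ≤ 1 * ‖ι z‖ := by
    rw [one_mul, hι]
    exact le_ciSup (hbdd z) m
  have hqle (z : ℕ →₀ ℝ) : ‖q z‖ ≤ 1 * ‖ι z‖ := by
    obtain ⟨N, hN⟩ := hq z
    rw [← hN N le_rfl]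
    exact hsle N z
  let S (m : ℕ) : E →L[ℝ] X := (s m).extendOfNorm ι
  let Q : E →L[ℝ] X := q.extendOfNorm ι
  have hS (m : ℕ) (z : ℕ →₀ ℝ) : S m (ι z) = s m z :=
    LinearMap.extendOfNorm_eq hιd ⟨1, hsle m⟩ z
  have hQ (z : ℕ →₀ ℝ) : Q (ι z) = q z := LinearMap.extendOfNorm_eq hιd ⟨1, hqle⟩ z
  have hSle (m : ℕ) (y : E) : ‖S m y‖ ≤ ‖y‖ := by
    simpa using LinearMap.norm_extendOfNorm_apply_le hιd 1 (hsle m) y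
  have hQle (y : E) : ‖Q y‖ ≤ ‖y‖ := by
    simpa using LinearMap.norm_extendOfNorm_apply_le hιd 1 hqle y
  refine ⟨S, Q, hSle, fun y ↦ ?_, fun m ↦ ?_, fun y ↦ ?_⟩
  · rcases eq_or_ne y 0 with rfl | hy
    · exact ⟨0, by simp⟩
    have hy : 0 < ‖y‖ := norm_pos_iff.2 hy
    obtain ⟨z, hz⟩ := hιd.exists_dist_lt y (show 0 < ‖y‖ / 8 by positivity)
    rw [dist_eq_norm] at hz
    have h1 : ‖y‖ - ‖ι z‖ ≤ ‖y - ι z‖ := norm_sub_norm_le _ _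
    obtain ⟨m, hm⟩ := exists_lt_of_lt_ciSup
      (show ‖ι z‖ - ‖y‖ / 8 < ⨆ m : ℕ, ‖s m z‖ by rw [← hι]; linarith)
    refine ⟨m, ?_⟩
    have h2 : ‖s m z‖ ≤ ‖S m y‖ + ‖y - ι z‖ := by
      rw [← hS, show S m (ι z) = S m y - S m (y - ι z) by simp]
      exact (norm_sub_le _ _).trans (by gcongr; exact hSle _ _)
    linarith
  · let F : Submodule ℝ X := Submodule.span ℝ (x '' Finset.range (m + 1))
    have : FiniteDimensional ℝ F :=
      FiniteDimensional.span_of_finite ℝ ((Finset.finite_toSet _).image x)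
    have hF : (S m : E →ₗ[ℝ] X).range ≤ F := by
      rintro _ ⟨y, rfl⟩
      refine hιd.induction_on (p := fun y ↦ S m y ∈ F) y ?_ fun z ↦ ?_
      · exact F.closed_of_finiteDimensional.preimage (S m).continuous
      · rw [hS, hs]
        exact F.sum_mem fun n hn ↦ F.smul_mem _ (Submodule.subset_span ⟨n, hn, rfl⟩)
    have := Submodule.finiteDimensional_of_le hF
    exact Module.Finite.iff_fg.1 this
  · rw [Metric.tendsto_atTop]
    intro ε hε
    obtain ⟨z, hz⟩ := hιd.exists_dist_lt y (half_pos hε)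
    rw [dist_eq_norm] at hz
    obtain ⟨N, hN⟩ := hq z
    refine ⟨N, fun m hm ↦ ?_⟩
    have : S m y - Q y = S m (y - ι z) - Q (y - ι z) := by
      simp only [map_sub, hS, hQ, hN m hm]
      abel
    rw [dist_eq_norm, this]
    linarith [norm_sub_le (S m (y - ι z)) (Q (y - ι z)), hSle m (y - ι z), hQle (y - ι z)]

/-- Let `Z` be an infinite-dimensional minimal Banach space
not containing an isomorphic copy of `c₀` (realized as `C₀(ℕ, ℝ)`).  If `X`
does not contain an isomorphic copy of `Z`, then neither does `E_X`. -/
theorem stmt_9 {X : Type*} [NormedAddCommGroup X] [NormedSpace ℝ X] [CompleteSpace X]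
    (x : ℕ → X) (hx1 : ∀ n, ‖x n‖ = 1)
    (hxd : ∀ y : X, ‖y‖ = 1 → ∀ ε : ℝ, 0 < ε → ∃ n, ‖y - x n‖ < ε)
    {E : Type*} [NormedAddCommGroup E] [NormedSpace ℝ E] [CompleteSpace E]
    (ι : (ℕ →₀ ℝ) →ₗ[ℝ] E) (hιd : DenseRange ι)
    (hnorm : ∀ z : ℕ →₀ ℝ,
      ‖ι z‖ = ⨆ m : ℕ, ‖∑ n ∈ Finset.range (m + 1), z n • x n‖)
    {Z : Type*} [NormedAddCommGroup Z] [NormedSpace ℝ Z] [CompleteSpace Z]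
    -- `Z` is infinite-dimensional
    (hZinf : ¬ FiniteDimensional ℝ Z)
    -- `Z` is minimal: every infinite-dimensional closed subspace of `Z`
    -- contains an isomorphic copy of `Z`
    (hmin : ∀ W : Submodule ℝ Z, IsClosed (W : Set Z) → ¬ FiniteDimensional ℝ W →
      ∃ T : Z →L[ℝ] W, ∃ c : ℝ, 0 < c ∧ ∀ z : Z, c * ‖z‖ ≤ ‖T z‖)
    -- `Z` does not contain an isomorphic copy of `c₀`
    (hZc0 : ¬ ∃ T : C₀(ℕ, ℝ) →L[ℝ] Z, ∃ c : ℝ, 0 < c ∧ ∀ f : C₀(ℕ, ℝ), c * ‖f‖ ≤ ‖T f‖)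
    -- `X` does not contain an isomorphic copy of `Z`
    (hXZ : ¬ ∃ T : Z →L[ℝ] X, ∃ c : ℝ, 0 < c ∧ ∀ z : Z, c * ‖z‖ ≤ ‖T z‖) :
    -- then `E_X` does not contain an isomorphic copy of `Z`
    ¬ ∃ T : Z →L[ℝ] E, ∃ c : ℝ, 0 < c ∧ ∀ z : Z, c * ‖z‖ ≤ ‖T z‖ := by
  rintro ⟨T, c, hc, hT⟩
  obtain ⟨S, Q, hS, hS', hfin, hlim⟩ := exists_partialSum_operators x ι hιd hnorm
  refine hZc0 (exists_embedding_zeroAtInfty_of_finiteRank_approx hZinf (fun m ↦ (S m).comp T)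
    (Q.comp T) (half_pos hc) (D := ‖T‖ + 1) (by positivity) (fun m z ↦ ?_) (fun z ↦ ?_)
    (fun m ↦ ?_) (fun z ↦ hlim (T z)) ?_)
  · have := T.le_opNorm z
    have := hS m (T z)
    change ‖S m (T z)‖ ≤ _
    linarith [norm_nonneg z]
  · obtain ⟨m, hm⟩ := hS' (T z)
    refine ⟨m, ?_⟩
    change _ ≤ ‖S m (T z)‖
    linarith [hT z]
  · have : Module.Finite ℝ (S m : E →ₗ[ℝ] X).range := Module.Finite.iff_fg.2 (hfin m)
    have hle : ((S m).comp T : Z →ₗ[ℝ] X).range ≤ (S m : E →ₗ[ℝ] X).range := by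
      rintro _ ⟨z, rfl⟩
      exact ⟨T z, rfl⟩
    exact Module.Finite.iff_fg.1 (Submodule.finiteDimensional_of_le hle)
  · rintro W hW hWinf ⟨ε, hε, hB⟩
    obtain ⟨R, r, hr, hR⟩ := hmin W hW hWinf
    refine hXZ ⟨(Q.comp T).comp (W.subtypeL.comp R), ε * r, by positivity, fun z ↦ ?_⟩
    calc ε * r * ‖z‖ = ε * (r * ‖z‖) := by ring
      _ ≤ ε * ‖R z‖ := by gcongr; exact hR z
      _ ≤ _ := hB (R z) (R z).2
end

section
/- Let D be a dyadic subtree of 2^{<ℕ} and let [D]_chains denote the set of all infinite chains of D (infinite subsets of D whose elements are pairwise comparable under ⊑), regarded as a subspace of the Cantor space 2^{2^{<ℕ}} of all subsets of 2^{<ℕ}. If 𝒳 is an analytic subset of [D]_chains, then there exists a dyadic subtree S of 2^{<ℕ} with S ⊆ D such that either [S]_chains ⊆ 𝒳 or [S]_chains ∩ 𝒳 = ∅. -/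
/-- `s` is a strict initial segment (proper prefix) of `t` in the dyadic tree
`2^{<ℕ}` (realized as `List Bool`). -/
def StrictPrefix (s t : List Bool) : Prop := s <+: t ∧ s ≠ t

/-- For incomparable nodes: `s ≺ t` iff `(s ∧ t)⌢0 ⊑ s` and `(s ∧ t)⌢1 ⊑ t`
where `s ∧ t` is the longest common initial segment of `s` and `t`
(equivalently, some common prefix `w` satisfies `w⌢0 ⊑ s` and `w⌢1 ⊑ t`). -/
def PrecRel (s t : List Bool) : Prop :=
  ∃ w : List Bool, (w ++ [false]) <+: s ∧ (w ++ [true]) <+: t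

/-- A dyadic subtree of `2^{<ℕ}`: an injective indexing `d : 2^{<ℕ} → 2^{<ℕ}`
preserving and reflecting both `⊏` and `≺`. -/
def IsDyadicSubtree (d : List Bool → List Bool) : Prop :=
  Function.Injective d ∧
  (∀ t₀ t₁ : List Bool, StrictPrefix t₀ t₁ ↔ StrictPrefix (d t₀) (d t₁)) ∧
  (∀ t₀ t₁ : List Bool, PrecRel t₀ t₁ ↔ PrecRel (d t₀) (d t₁))

/-- The set `[D]_chains` of infinite chains of a set `D ⊆ 2^{<ℕ}`, viewed
inside the Cantor space `2^(2^{<ℕ})` of all subsets of `2^{<ℕ}` (a subset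
being coded by its characteristic function `χ : List Bool → Bool`): those `χ`
whose support is an infinite subset of `D` consisting of pairwise comparable
nodes. -/
def InfiniteChains (D : Set (List Bool)) : Set (List Bool → Bool) :=
  {χ | ({t | χ t = true}).Infinite ∧ {t | χ t = true} ⊆ D ∧
    ∀ s ∈ {t | χ t = true}, ∀ t ∈ {t' | χ t' = true}, s <+: t ∨ t <+: s}

open Set

/-- Each node `d t` has an extension `w` at which the images of the two successors of `t`
split. -/
def IsBranching (d : List Bool → List Bool) : Prop :=
  ∀ t, ∃ w, d t <+: w ∧ ∀ b, w ++ [b] <+: d (t ++ [b])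

namespace StrictPrefix

theorem trans {s t u : List Bool} (h : StrictPrefix s t) (h' : StrictPrefix t u) :
    StrictPrefix s u :=
  ⟨h.1.trans h'.1, fun e => h.2 (h.1.eq_of_length_le (e ▸ h'.1.length_le))⟩

theorem length_lt {s t : List Bool} (h : StrictPrefix s t) : s.length < t.length :=
  lt_of_not_ge fun h' => h.2 (h.1.eq_of_length_le h')

theorem of_append_singleton {s t w : List Bool} {b : Bool} (h : s <+: w) (h' : w ++ [b] <+: t) :
    StrictPrefix s t := by
  refine ⟨h.trans ((List.prefix_append w [b]).trans h'), ?_⟩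
  rintro rfl
  have h₁ := h.length_le
  have h₂ := h'.length_le
  simp at h₂
  omega

theorem exists_append_cons {s t : List Bool} (h : StrictPrefix s t) :
    ∃ b u, t = s ++ b :: u := by
  obtain ⟨⟨u, rfl⟩, hne⟩ := h
  cases u with
  | nil => simp at hne
  | cons b u => exact ⟨b, u, rfl⟩

end StrictPrefix

theorem eq_or_strictPrefix_or_precRel (s t : List Bool) :
    s = t ∨ StrictPrefix s t ∨ StrictPrefix t s ∨ PrecRel s t ∨ PrecRel t s := by
  induction s generalizing t with
  | nil =>
    cases t with
    | nil => simp
    | cons b t => exact Or.inr (Or.inl ⟨by simp, by simp⟩)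
  | cons a s ih =>
    cases t with
    | nil => exact Or.inr (Or.inr (Or.inl ⟨by simp, by simp⟩))
    | cons b t =>
      by_cases hab : a = b
      · subst hab
        rcases ih t with h | h | h | ⟨w, h⟩ | ⟨w, h⟩
        · simp [h]
        · exact Or.inr (Or.inl ⟨by simpa using h.1, by simpa using h.2⟩)
        · exact Or.inr (Or.inr (Or.inl ⟨by simpa using h.1, by simpa using h.2⟩))
        · exact Or.inr (Or.inr (Or.inr (Or.inl ⟨a :: w, by simpa using h⟩)))
        · exact Or.inr (Or.inr (Or.inr (Or.inr ⟨a :: w, by simpa using h⟩)))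
      · cases a <;> cases b <;> simp at hab
        · exact Or.inr (Or.inr (Or.inr (Or.inl ⟨[], by simp⟩)))
        · exact Or.inr (Or.inr (Or.inr (Or.inr ⟨[], by simp⟩)))

theorem not_prefix_of_append_singleton {s t w : List Bool} {b c : Bool} (hbc : b ≠ c)
    (hs : w ++ [b] <+: s) (ht : w ++ [c] <+: t) : ¬ s <+: t := by
  intro h
  have := (List.prefix_of_prefix_length_le (hs.trans h) ht (by simp)).eq_of_length (by simp)
  simp at this
  exact hbc this

theorem PrecRel.incomparable {s t : List Bool} (h : PrecRel s t) : ¬ s <+: t ∧ ¬ t <+: s := by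
  obtain ⟨w, hs, ht⟩ := h
  exact ⟨not_prefix_of_append_singleton (by simp) hs ht,
    not_prefix_of_append_singleton (by simp) ht hs⟩

theorem PrecRel.asymm {s t : List Bool} (h : PrecRel s t) : ¬ PrecRel t s := by
  rintro ⟨v, hv⟩
  obtain ⟨w, hw⟩ := h
  rcases lt_trichotomy v.length w.length with hlt | heq | hlt
  · have h₁ := List.prefix_of_prefix_length_le hv.1 ((List.prefix_append _ _).trans hw.2)
      (by simp; omega)
    exact not_prefix_of_append_singleton (by simp) h₁ hv.2
      ((List.prefix_append _ _).trans hw.1)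
  · have h₁ := (List.prefix_of_prefix_length_le hv.1 hw.2 (by simp [heq])).eq_of_length
      (by simp [heq])
    have h₂ := List.append_inj_right h₁ heq
    simp at h₂
  · have h₁ := List.prefix_of_prefix_length_le hw.1 ((List.prefix_append _ _).trans hv.2)
      (by simp; omega)
    exact not_prefix_of_append_singleton (by simp) h₁ hw.2
      ((List.prefix_append _ _).trans hv.1)

theorem not_prefix_of_strictPrefix {s t : List Bool} (h : StrictPrefix s t) : ¬ t <+: s :=
  fun h' => absurd h'.length_le (not_le.2 h.length_lt)

namespace IsBranching

variable {d : List Bool → List Bool}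

theorem prefix_append (hd : IsBranching d) (t u : List Bool) : d t <+: d (t ++ u) := by
  induction u using List.reverseRecOn with
  | nil => simp
  | append_singleton u b ih =>
    obtain ⟨w, hw, hb⟩ := hd (t ++ u)
    rw [← List.append_assoc]
    exact ih.trans (hw.trans ((List.prefix_append _ _).trans (hb b)))

theorem exists_split (hd : IsBranching d) (t : List Bool) :
    ∃ w, d t <+: w ∧ ∀ b u, w ++ [b] <+: d (t ++ b :: u) := by
  obtain ⟨w, hw, hb⟩ := hd t
  exact ⟨w, hw, fun b u => (hb b).trans (by simpa using hd.prefix_append (t ++ [b]) u)⟩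

theorem strictPrefix (hd : IsBranching d) {s t : List Bool} (h : StrictPrefix s t) :
    StrictPrefix (d s) (d t) := by
  obtain ⟨b, u, rfl⟩ := h.exists_append_cons
  obtain ⟨w, hw, hb⟩ := hd.exists_split s
  exact .of_append_singleton hw (hb b u)

theorem precRel (hd : IsBranching d) {s t : List Bool} (h : PrecRel s t) :
    PrecRel (d s) (d t) := by
  obtain ⟨v, ⟨s, rfl⟩, ⟨t, rfl⟩⟩ := h
  obtain ⟨w, hw, hb⟩ := hd.exists_split v
  exact ⟨w, by simpa using hb false s, by simpa using hb true t⟩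

theorem isDyadicSubtree (hd : IsBranching d) : IsDyadicSubtree d := by
  refine ⟨fun s t h => ?_, fun s t => ⟨hd.strictPrefix, fun h => ?_⟩,
    fun s t => ⟨hd.precRel, fun h => ?_⟩⟩
  · rcases eq_or_strictPrefix_or_precRel s t with h' | h' | h' | h' | h'
    · exact h'
    · exact absurd h (hd.strictPrefix h').2
    · exact absurd h.symm (hd.strictPrefix h').2
    · exact absurd (h ▸ List.prefix_refl _) (hd.precRel h').incomparable.1
    · exact absurd (h ▸ List.prefix_refl _) (hd.precRel h').incomparable.1
  · rcases eq_or_strictPrefix_or_precRel s t with h' | h' | h' | h' | h'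
    · exact absurd (congrArg d h') h.2
    · exact h'
    · exact absurd h.1 (not_prefix_of_strictPrefix (hd.strictPrefix h'))
    · exact absurd h.1 (hd.precRel h').incomparable.1
    · exact absurd h.1 (hd.precRel h').incomparable.2
  · rcases eq_or_strictPrefix_or_precRel s t with h' | h' | h' | h' | h'
    · exact absurd (h' ▸ List.prefix_refl _) h.incomparable.1
    · exact absurd (hd.strictPrefix h').1 h.incomparable.1
    · exact absurd (hd.strictPrefix h').1 h.incomparable.2
    · exact h'
    · exact absurd h (hd.precRel h').asymm

theorem comp_append (hd : IsBranching d) (s : List Bool) : IsBranching fun u => d (s ++ u) :=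
  fun t => by simpa using hd (s ++ t)

theorem comp (hd : IsBranching d) {e : List Bool → List Bool} (he : IsBranching e) :
    IsBranching (d ∘ e) := by
  intro t
  obtain ⟨w, hw, hb⟩ := he t
  obtain ⟨v, hv, hc⟩ := hd.exists_split w
  obtain ⟨u, rfl⟩ := hw
  refine ⟨v, (hd.prefix_append _ _).trans hv, fun b => ?_⟩
  obtain ⟨u', hu'⟩ := hb b
  simpa [← hu'] using hc b u'

end IsBranching

theorem IsDyadicSubtree.isBranching {d : List Bool → List Bool} (hd : IsDyadicSubtree d) :
    IsBranching d := by
  intro t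
  obtain ⟨w, h₀, h₁⟩ := (hd.2.2 (t ++ [false]) (t ++ [true])).1 ⟨t, by simp⟩
  have hs : ∀ b, d t <+: d (t ++ [b]) := fun b => ((hd.2.1 _ _).1 ⟨by simp, by simp⟩).1
  refine ⟨w, ?_, fun b => by cases b <;> assumption⟩
  by_contra hw
  have hlt : (w ++ [false]).length ≤ (d t).length := by
    by_contra hlt
    exact hw (List.prefix_of_prefix_length_le (hs false) ((List.prefix_append _ _).trans h₀)
      (by simp at hlt; omega))
  exact not_prefix_of_append_singleton (by simp)
    (List.prefix_of_prefix_length_le h₀ (hs false) hlt) h₁ (hs true)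

/-- Every set of nodes contains, or misses, a dyadic subtree of any given dyadic tree. -/
theorem IsBranching.exists_subset_or_subset_compl {d : List Bool → List Bool}
    (hd : IsBranching d) (c : Set (List Bool)) :
    ∃ e, IsBranching e ∧ range e ⊆ range d ∧ (range e ⊆ c ∨ range e ⊆ cᶜ) := by
  by_cases h : ∃ s, ∀ u, d (s ++ u) ∉ c
  · obtain ⟨s, hs⟩ := h
    refine ⟨_, hd.comp_append s, ?_, Or.inr ?_⟩
    · rintro _ ⟨u, rfl⟩
      exact mem_range_self _
    · rintro _ ⟨u, rfl⟩
      exact hs u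
  · push Not at h
    choose g hg using h
    let e : List Bool → List Bool := fun t =>
      t.foldl (fun s b => s ++ [b] ++ g (s ++ [b])) (g [])
    have he : IsBranching e := fun t =>
      ⟨e t, List.prefix_refl _, fun b => by simp [e, List.foldl_append]⟩
    refine ⟨d ∘ e, hd.comp he, range_comp_subset_range e d, Or.inl ?_⟩
    rintro _ ⟨t, rfl⟩
    induction t using List.reverseRecOn with
    | nil => simpa [e] using hg []
    | append_singleton t b _ =>
      simpa [e, List.foldl_append] using hg (e t ++ [b])

/-- The elements of `A` strictly extending `r`. -/
def nodesAbove (A : Set (List Bool)) (r : List Bool) : Set (List Bool) :=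
  {v ∈ A | StrictPrefix r v}

theorem nodesAbove_mono {A B : Set (List Bool)} (h : A ⊆ B) (r : List Bool) :
    nodesAbove A r ⊆ nodesAbove B r :=
  fun _ hv => ⟨h hv.1, hv.2⟩

theorem IsBranching.exists_subset_nodesAbove {d : List Bool → List Bool} (hd : IsBranching d)
    {r : List Bool} (hr : r ∈ range d) :
    ∃ e, IsBranching e ∧ range e ⊆ nodesAbove (range d) r := by
  obtain ⟨t, rfl⟩ := hr
  refine ⟨_, hd.comp_append (t ++ [false]), ?_⟩
  rintro _ ⟨u, rfl⟩
  exact ⟨mem_range_self _, hd.strictPrefix ⟨by simp, by simp⟩⟩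

/-- A hereditary property that is dense for finitely many indices simultaneously. -/
theorem exists_forall_mem_of_finite {ι : Type*} {P : ι → Set (List Bool) → Prop}
    (hP : ∀ i A B, A ⊆ B → P i B → P i A) {D : Set (List Bool)}
    (hdense : ∀ i e, IsBranching e → range e ⊆ D →
      ∃ e', IsBranching e' ∧ range e' ⊆ range e ∧ P i (range e'))
    {F : Set ι} (hF : F.Finite) {e : List Bool → List Bool} (he : IsBranching e)
    (heD : range e ⊆ D) :
    ∃ e', IsBranching e' ∧ range e' ⊆ range e ∧ ∀ i ∈ F, P i (range e') := by
  induction F, hF using Set.Finite.induction_on with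
  | empty => exact ⟨e, he, Subset.rfl, by simp⟩
  | insert _ _ ih =>
    obtain ⟨e₁, he₁, hs₁, h₁⟩ := ih
    obtain ⟨e₂, he₂, hs₂, h₂⟩ := hdense _ e₁ he₁ (hs₁.trans heD)
    refine ⟨e₂, he₂, hs₂.trans hs₁, ?_⟩
    rintro i (rfl | hi)
    · exact h₂
    · exact hP i _ _ hs₂ (h₁ i hi)

/-- Fusion: a hereditary property that is dense below `d` can be realized above all nodes of a
single subtree. -/
theorem IsBranching.fusion {ι : Type*} {P : ι → Set (List Bool) → Prop}
    (hP : ∀ i A B, A ⊆ B → P i B → P i A) {d : List Bool → List Bool} (hd : IsBranching d)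
    (hdense : ∀ i e, IsBranching e → range e ⊆ range d →
      ∃ e', IsBranching e' ∧ range e' ⊆ range e ∧ P i (range e'))
    {F : List Bool → Set ι} (hF : ∀ r, (F r).Finite) :
    ∃ e, IsBranching e ∧ range e ⊆ range d ∧
      ∀ r ∈ range e, ∀ i ∈ F r, P i (nodesAbove (range e) r) := by
  let T := {e : List Bool → List Bool // IsBranching e ∧ range e ⊆ range d}
  have hR : ∀ e : T, ∃ e' : T, range e'.1 ⊆ nodesAbove (range e.1) (e.1 []) ∧
      ∀ i ∈ F (e.1 []), P i (range e'.1) := by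
    intro e
    obtain ⟨e₁, he₁, hs₁⟩ := e.2.1.exists_subset_nodesAbove (mem_range_self [])
    have hs₁' : range e₁ ⊆ range d := fun v hv => e.2.2 (hs₁ hv).1
    obtain ⟨e₂, he₂, hs₂, h₂⟩ := exists_forall_mem_of_finite hP hdense (hF (e.1 [])) he₁ hs₁'
    exact ⟨⟨e₂, he₂, hs₂.trans hs₁'⟩, hs₂.trans hs₁, h₂⟩
  choose R hR hRP using hR
  let next : T → Bool → T := fun e b =>
    ⟨fun u => (R e).1 ([b] ++ u), (R e).2.1.comp_append [b], by
      rintro _ ⟨u, rfl⟩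
      exact (R e).2.2 (mem_range_self _)⟩
  let stage : List Bool → T := fun t => t.foldl next ⟨d, hd, Subset.rfl⟩
  have hstage : ∀ t b, stage (t ++ [b]) = next (stage t) b := fun t b => by
    simp [stage, List.foldl_append]
  have hnext : ∀ e b, range (next e b).1 ⊆ range (R e).1 := by
    rintro e b _ ⟨u, rfl⟩
    exact mem_range_self _
  have hanti : ∀ t u, range (stage (t ++ u)).1 ⊆ range (stage t).1 := by
    intro t u
    induction u using List.reverseRecOn with
    | nil => simp
    | append_singleton u b ih =>
      rw [← List.append_assoc, hstage]
      exact ((hnext _ _).trans fun v hv => (hR _ hv).1).trans ih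
  have he : IsBranching fun t => (stage t).1 [] := by
    intro t
    obtain ⟨w, hw, hb⟩ := (R (stage t)).2.1 []
    refine ⟨w, (hR (stage t) (mem_range_self [])).2.1.trans hw, fun b => ?_⟩
    simpa [hstage, next] using hb b
  refine ⟨_, he, ?_, ?_⟩
  · rintro _ ⟨t, rfl⟩
    exact (stage t).2.2 (mem_range_self _)
  · rintro _ ⟨t, rfl⟩ i hi
    refine hP i _ _ ?_ (hRP (stage t) i hi)
    rintro _ ⟨⟨u, rfl⟩, hu⟩
    obtain ⟨b, u, rfl⟩ := ((he.isDyadicSubtree.2.1 t u).2 hu).exists_append_cons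
    have := (hanti (t ++ [b]) u).trans (hstage t b ▸ hnext _ _)
    simpa using this (mem_range_self [])

/-- The list of the first `k` terms of `x`. -/
def initSeg {β : Type*} (x : ℕ → β) (k : ℕ) : List β := (List.range k).map x

@[simp]
theorem length_initSeg {β : Type*} (x : ℕ → β) (k : ℕ) : (initSeg x k).length = k := by
  simp [initSeg]

theorem initSeg_succ {β : Type*} (x : ℕ → β) (k : ℕ) :
    initSeg x (k + 1) = initSeg x k ++ [x k] := by
  simp [initSeg, List.range_succ]

theorem initSeg_eq_initSeg {β : Type*} {x y : ℕ → β} {k : ℕ} :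
    initSeg x k = initSeg y k ↔ ∀ i < k, x i = y i := by
  simp [initSeg]

/-- A sequence of nodes each of which strictly extends the previous one. -/
def IsChainSeq (x : ℕ → List Bool) : Prop := ∀ n, StrictPrefix (x n) (x (n + 1))

namespace IsChainSeq

variable {x : ℕ → List Bool}

theorem strictPrefix (hx : IsChainSeq x) {m n : ℕ} (h : m < n) : StrictPrefix (x m) (x n) := by
  induction n, h using Nat.le_induction with
  | base => exact hx m
  | succ n _ ih => exact ih.trans (hx n)

theorem strictMono_length (hx : IsChainSeq x) : StrictMono fun n => (x n).length :=
  strictMono_nat_of_lt_succ fun n => (hx n).length_lt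

theorem le_length (hx : IsChainSeq x) (n : ℕ) : n ≤ (x n).length :=
  hx.strictMono_length.le_apply

end IsChainSeq

/-- The chain sequences extending `a` whose further terms lie in `A`. -/
def cyl (a : List (List Bool)) (A : Set (List Bool)) : Set (ℕ → List Bool) :=
  {x | IsChainSeq x ∧ initSeg x a.length = a ∧ ∀ n, a.length ≤ n → x n ∈ A}

theorem cyl_mono {a : List (List Bool)} {A B : Set (List Bool)} (h : A ⊆ B) :
    cyl a A ⊆ cyl a B :=
  fun _ hx => ⟨hx.1, hx.2.1, fun n hn => h (hx.2.2 n hn)⟩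

theorem mem_cyl_initSeg {a : List (List Bool)} {A : Set (List Bool)} {x : ℕ → List Bool}
    (hx : x ∈ cyl a A) {k : ℕ} (hk : a.length ≤ k) :
    x ∈ cyl (initSeg x (k + 1)) (nodesAbove A (x k)) := by
  refine ⟨hx.1, by simp, fun n hn => ?_⟩
  rw [length_initSeg] at hn
  exact ⟨hx.2.2 n (by omega), hx.1.strictPrefix (by omega)⟩

/-- A finite set of lists of nodes containing every finite chain with last element `r`. -/
def stems (r : List Bool) : Set (List (List Bool)) :=
  {a | a.length ≤ r.length + 1 ∧ ∀ v ∈ a, v.length ≤ r.length}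

theorem finite_stems (r : List Bool) : (stems r).Finite := by
  have : Finite {v : List Bool | v.length ≤ r.length} :=
    (List.finite_length_le Bool r.length).to_subtype
  refine ((List.finite_length_le {v : List Bool | v.length ≤ r.length} (r.length + 1)).image
    (List.map Subtype.val)).subset ?_
  rintro a ⟨h₁, h₂⟩
  refine ⟨a.attach.map fun v => ⟨v.1, h₂ v.1 v.2⟩, ?_, by simp⟩
  rw [mem_ofPred_eq, List.length_map, List.length_attach]
  exact h₁

theorem IsChainSeq.initSeg_mem_stems {x : ℕ → List Bool} (hx : IsChainSeq x) (k : ℕ) :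
    initSeg x (k + 1) ∈ stems (x k) := by
  refine ⟨by simpa using hx.le_length k, fun v hv => ?_⟩
  simp only [initSeg, List.mem_map, List.mem_range] at hv
  obtain ⟨i, hi, rfl⟩ := hv
  exact hx.strictMono_length.monotone (by omega)

/-- All chain sequences that extend `a` inside `A` belong to `O`. -/
def Accepts (O : Set (ℕ → List Bool)) (a : List (List Bool)) (A : Set (List Bool)) : Prop :=
  cyl a A ⊆ O

/-- No dyadic subtree of `A` accepts `a`. -/
def Rejects (O : Set (ℕ → List Bool)) (a : List (List Bool)) (A : Set (List Bool)) : Prop :=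
  ∀ e, IsBranching e → range e ⊆ A → ¬ Accepts O a (range e)

section

variable {O : Set (ℕ → List Bool)} {a : List (List Bool)} {A B : Set (List Bool)}

theorem Accepts.mono (h : A ⊆ B) (hB : Accepts O a B) : Accepts O a A :=
  (cyl_mono h).trans hB

theorem Rejects.mono (h : A ⊆ B) (hB : Rejects O a B) : Rejects O a A :=
  fun e he hs => hB e he (hs.trans h)

theorem Rejects.not_accepts {e : List Bool → List Bool} (he : IsBranching e)
    (h : Rejects O a A) (hs : range e ⊆ A) : ¬ Accepts O a A :=
  fun h' => h e he hs (h'.mono hs)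

theorem exists_accepts_or_rejects (O : Set (ℕ → List Bool)) (a : List (List Bool))
    {e : List Bool → List Bool} (he : IsBranching e) :
    ∃ e', IsBranching e' ∧ range e' ⊆ range e ∧
      (Accepts O a (range e') ∨ Rejects O a (range e')) := by
  by_cases h : Rejects O a (range e)
  · exact ⟨e, he, Subset.rfl, Or.inr h⟩
  · simp only [Rejects, not_forall, not_not] at h
    obtain ⟨e', he', hs, hacc⟩ := h
    exact ⟨e', he', hs, Or.inl hacc⟩

end

/-- Below every dyadic tree there is a subtree that decides, above each of its nodes, the
finitely many indices assigned to that node. -/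
theorem IsBranching.exists_decided {ι : Type*} (O : ι → Set (ℕ → List Bool))
    (a : ι → List (List Bool)) {F : List Bool → Set ι} (hF : ∀ r, (F r).Finite)
    {d : List Bool → List Bool} (hd : IsBranching d) :
    ∃ e, IsBranching e ∧ range e ⊆ range d ∧ ∀ r ∈ range e, ∀ i ∈ F r,
      Accepts (O i) (a i) (nodesAbove (range e) r) ∨
        Rejects (O i) (a i) (nodesAbove (range e) r) :=
  hd.fusion (P := fun i A => Accepts (O i) (a i) A ∨ Rejects (O i) (a i) A)
    (fun _ _ _ hAB h => h.imp (.mono hAB) (.mono hAB))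
    (fun i _ he _ => exists_accepts_or_rejects (O i) (a i) he) hF

/-- The partition theorem for sets of chain sequences that are open. -/
theorem IsBranching.exists_accepts_or_accepts_compl {O : Set (ℕ → List Bool)}
    (hO : ∀ x ∈ O, ∃ k, ∀ y, initSeg y k = initSeg x k → y ∈ O) (a : List (List Bool))
    {d : List Bool → List Bool} (hd : IsBranching d) :
    ∃ e, IsBranching e ∧ range e ⊆ range d ∧
      (Accepts O a (range e) ∨ Accepts Oᶜ a (range e)) := by
  obtain ⟨e₁, he₁, hs₁, h₁⟩ := hd.exists_decided (fun _ => O) id finite_stems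
  let P : List (List Bool) → Set (List Bool) → Prop := fun a A =>
    Accepts O a A ∨ ∀ t ∈ A, Rejects O (a ++ [t]) (nodesAbove A t)
  have hP : ∀ a A B, A ⊆ B → P a B → P a A := fun a A B hAB h =>
    h.imp (.mono hAB) fun h t ht => (h t (hAB ht)).mono (nodesAbove_mono hAB t)
  have hdense : ∀ a e, IsBranching e → range e ⊆ range e₁ →
      ∃ e', IsBranching e' ∧ range e' ⊆ range e ∧ P a (range e') := by
    intro a e he hs
    obtain ⟨e₂, he₂, hs₂, h₂ | hrej⟩ := exists_accepts_or_rejects O a he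
    · exact ⟨e₂, he₂, hs₂, Or.inl h₂⟩
    obtain ⟨e₃, he₃, hs₃, h₃ | h₃⟩ := he₂.exists_subset_or_subset_compl
      {t | Rejects O (a ++ [t]) (nodesAbove (range e₁) t)}
    · exact ⟨e₃, he₃, hs₃.trans hs₂, Or.inr fun t ht =>
        (h₃ ht).mono (nodesAbove_mono (hs₃.trans (hs₂.trans hs)) t)⟩
    · refine absurd (fun x hx => ?_) (hrej e₃ he₃ hs₃)
      have hxa : x a.length ∈ range e₃ := hx.2.2 _ le_rfl
      have hseg : initSeg x (a.length + 1) = a ++ [x a.length] := by rw [initSeg_succ, hx.2.1]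
      have hsub : range e₃ ⊆ range e₁ := hs₃.trans (hs₂.trans hs)
      rcases h₁ _ (hsub hxa) _ (hx.1.initSeg_mem_stems _) with h | h
      · exact h (cyl_mono (nodesAbove_mono hsub _) (mem_cyl_initSeg hx le_rfl))
      · rw [id, hseg] at h
        exact absurd h (h₃ hxa)
  obtain ⟨e₂, he₂, hs₂, h₂⟩ := hdense a e₁ he₁ Subset.rfl
  obtain ⟨e₃, he₃, hs₃, h₃⟩ := he₂.fusion hP
    (fun a e he hs => hdense a e he (hs.trans hs₂)) finite_stems
  refine ⟨e₃, he₃, hs₃.trans (hs₂.trans hs₁), (hP _ _ _ hs₃ h₂).imp_right fun hrej x hx hxO => ?_⟩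
  have key : ∀ k, a.length ≤ k →
      Rejects O (initSeg x (k + 1)) (nodesAbove (range e₃) (x k)) := by
    intro k hk
    induction k, hk using Nat.le_induction with
    | base =>
      rw [initSeg_succ, hx.2.1]
      exact hrej _ (hx.2.2 _ le_rfl)
    | succ k hk ih =>
      obtain ⟨e, he, hs⟩ := he₃.exists_subset_nodesAbove (hx.2.2 k hk)
      have hnext := (h₃ _ (hx.2.2 k hk) _ (hx.1.initSeg_mem_stems k)).resolve_left
        (ih.not_accepts he hs) _ ⟨hx.2.2 (k + 1) (by omega), hx.1 k⟩
      rw [initSeg_succ]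
      refine Rejects.mono ?_ hnext
      rintro v ⟨hv, hlt⟩
      exact ⟨⟨hv, (hx.1 k).trans hlt⟩, hlt⟩
  obtain ⟨k, hk⟩ := hO x hxO
  have hle := le_max_left a.length k
  obtain ⟨e, he, hs⟩ := he₃.exists_subset_nodesAbove (hx.2.2 _ hle)
  refine (key _ hle).not_accepts he hs fun y hy => hk y ?_
  have := hy.2.1
  rw [length_initSeg, initSeg_eq_initSeg] at this
  rw [initSeg_eq_initSeg]
  exact fun i hi => this i (by omega)

theorem exists_initSeg_of_step {Q : List ℕ → ℕ → Prop} {k₀ : ℕ} (h₀ : Q [] k₀)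
    (hstep : ∀ s k, Q s k → ∃ n, ∃ k' > k, Q (s ++ [n]) k') :
    ∃ z : ℕ → ℕ, ∀ i, ∃ k ≥ i, Q (initSeg z i) k := by
  choose n k' hk hQ using fun p : {p : List ℕ × ℕ // Q p.1 p.2} => hstep p.1.1 p.1.2 p.2
  let st : ℕ → {p : List ℕ × ℕ // Q p.1 p.2} := fun i =>
    Nat.rec ⟨([], k₀), h₀⟩ (fun _ p => ⟨(p.1.1 ++ [n p], k' p), hQ p⟩) i
  have hst : ∀ i, (st i).1.1 = initSeg (fun j => n (st j)) i := by
    intro i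
    induction i with
    | zero => rfl
    | succ i ih => rw [initSeg_succ, ← ih]
  have hki : ∀ i, i ≤ (st i).1.2 := by
    intro i
    induction i with
    | zero => exact Nat.zero_le _
    | succ i ih => exact lt_of_le_of_lt ih (hk (st i))
  exact ⟨fun j => n (st j), fun i => ⟨_, hki i, hst i ▸ (st i).2⟩⟩

open scoped Classical in
/-- The indicator function of the range of `x`. -/
noncomputable def rangeIndicator (x : ℕ → List Bool) (t : List Bool) : Bool :=
  decide (t ∈ range x)

theorem rangeIndicator_eq_true_iff (x : ℕ → List Bool) (t : List Bool) :
    rangeIndicator x t = true ↔ t ∈ range x := by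
  simp [rangeIndicator]

theorem IsChainSeq.rangeIndicator_congr {x y : ℕ → List Bool} (hx : IsChainSeq x)
    (hy : IsChainSeq y) {k : ℕ} (h : ∀ i < k, y i = x i) {t : List Bool} (ht : t.length < k) :
    rangeIndicator y t = rangeIndicator x t := by
  rw [Bool.eq_iff_iff, rangeIndicator_eq_true_iff, rangeIndicator_eq_true_iff]
  constructor
  · rintro ⟨n, rfl⟩
    exact ⟨n, (h n ((hy.le_length n).trans_lt ht)).symm⟩
  · rintro ⟨n, rfl⟩
    exact ⟨n, h n ((hx.le_length n).trans_lt ht)⟩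

theorem exists_isChainSeq {D : Set (List Bool)} {χ : List Bool → Bool}
    (hχ : χ ∈ InfiniteChains D) :
    ∃ x, IsChainSeq x ∧ (∀ n, x n ∈ D) ∧ rangeIndicator x = χ := by
  obtain ⟨hinf, hD, hcomp⟩ := hχ
  let p : ℕ → Prop := fun n => ∃ t, χ t = true ∧ t.length = n
  have hp : (Set.ofPred p).Infinite := by
    refine (hinf.image (f := List.length) fun s hs t ht hst => ?_).mono ?_
    · rcases hcomp s hs t ht with h | h
      · exact h.eq_of_length hst
      · exact (h.eq_of_length hst.symm).symm
    · rintro _ ⟨t, ht, rfl⟩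
      exact ⟨t, ht, rfl⟩
  choose x hx hlen using fun n => Nat.nth_mem_of_infinite hp n
  have hlt : ∀ n, (x n).length < (x (n + 1)).length := fun n => by
    rw [hlen, hlen]
    exact Nat.nth_strictMono hp n.lt_succ_self
  refine ⟨x, fun n => ?_, fun n => hD (hx n), ?_⟩
  · have hne : x n ≠ x (n + 1) := fun h => (hlt n).ne (congrArg _ h)
    rcases hcomp _ (hx n) _ (hx (n + 1)) with h | h
    · exact ⟨h, hne⟩
    · exact absurd h.length_le (not_le.2 (hlt n))
  · funext t
    refine Bool.eq_iff_iff.2 ((rangeIndicator_eq_true_iff x t).trans ?_)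
    constructor
    · rintro ⟨n, rfl⟩
      exact hx n
    · intro ht
      obtain ⟨n, hn⟩ : t.length ∈ range (Nat.nth p) := by
        rw [Nat.range_nth_of_infinite hp]
        exact ⟨t, ht, rfl⟩
      have heq : (x n).length = t.length := (hlen n).trans hn
      rcases hcomp _ (hx n) _ ht with h | h
      · exact ⟨n, h.eq_of_length heq⟩
      · exact ⟨n, (h.eq_of_length heq.symm).symm⟩

/-- The partition theorem for chain sequences whose range is in the continuous image of the
Baire space. -/
theorem IsBranching.exists_mem_range_or_notMem_range {f : (ℕ → ℕ) → List Bool → Bool}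
    (hf : Continuous f) {d : List Bool → List Bool} (hd : IsBranching d) :
    ∃ e, IsBranching e ∧ range e ⊆ range d ∧
      ((∀ x ∈ cyl [] (range e), rangeIndicator x ∈ range f) ∨
        ∀ x ∈ cyl [] (range e), rangeIndicator x ∉ range f) := by
  let N : List ℕ → Set (ℕ → List Bool) := fun s =>
    {x | ¬ ∃ z, initSeg z s.length = s ∧ f z = rangeIndicator x}
  let F : List Bool → Set (List (List Bool) × List ℕ) := fun r =>
    stems r ×ˢ {s | Encodable.encode s ≤ r.length}
  have hF : ∀ r, (F r).Finite := fun r => (finite_stems r).prod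
    ((Set.finite_Iic r.length).preimage Encodable.encode_injective.injOn)
  obtain ⟨e₁, he₁, hs₁, h₁⟩ := hd.exists_decided (fun i => N i.2) Prod.fst hF
  let Q : (ℕ → List Bool) → List ℕ → ℕ → Prop := fun x s k =>
    Encodable.encode s ≤ (x k).length ∧
      Rejects (N s) (initSeg x (k + 1)) (nodesAbove (range e₁) (x k))
  let O : List (List Bool) × List ℕ → Set (ℕ → List Bool) := fun i =>
    {x | ∃ n, ∃ k ≥ i.1.length, Q x (i.2 ++ [n]) k}
  have hO : ∀ i, ∀ x ∈ O i, ∃ k, ∀ y, initSeg y k = initSeg x k → y ∈ O i := by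
    rintro i x ⟨n, k, hk, hQ⟩
    refine ⟨k + 1, fun y hy => ⟨n, k, hk, ?_⟩⟩
    have hyk : y k = x k := initSeg_eq_initSeg.1 hy k k.lt_succ_self
    simpa only [Q, hy, hyk] using hQ
  let P : List (List Bool) × List ℕ → Set (List Bool) → Prop := fun i A =>
    Accepts (N i.2) i.1 A ∨ Accepts (O i) i.1 A
  have hP : ∀ i A B, A ⊆ B → P i B → P i A := fun i A B hAB h =>
    h.imp (.mono hAB) (.mono hAB)
  have hdense : ∀ i e, IsBranching e → range e ⊆ range e₁ →
      ∃ e', IsBranching e' ∧ range e' ⊆ range e ∧ P i (range e') := by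
    intro i e he hs
    obtain ⟨e₂, he₂, hs₂, h₂ | h₂⟩ := he.exists_accepts_or_accepts_compl (hO i) i.1
    · exact ⟨e₂, he₂, hs₂, Or.inr h₂⟩
    refine ⟨e₂, he₂, hs₂, Or.inl ?_⟩
    rintro x hx ⟨z, hz, hfz⟩
    set s := i.2 ++ [z i.2.length] with hsdef
    set k := max i.1.length (Encodable.encode s)
    have hk : i.1.length ≤ k := le_max_left _ _
    have hcode : Encodable.encode s ≤ (x k).length := (le_max_right _ _).trans (hx.1.le_length k)
    have hxk : x k ∈ range e₁ := hs (hs₂ (hx.2.2 k hk))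
    rcases h₁ _ hxk (initSeg x (k + 1), s) ⟨hx.1.initSeg_mem_stems k, hcode⟩ with h | h
    · refine h (cyl_mono (nodesAbove_mono (hs₂.trans hs) _) (mem_cyl_initSeg hx hk)) ⟨z, ?_, hfz⟩
      simp [hsdef, initSeg_succ, hz]
    · exact h₂ hx ⟨_, k, hk, hcode, h⟩
  obtain ⟨e₂, he₂, hs₂, h₂⟩ := hdense ([], []) e₁ he₁ Subset.rfl
  obtain ⟨e₃, he₃, hs₃, h₃⟩ := he₂.fusion hP
    (fun i e he hs => hdense i e he (hs.trans hs₂)) hF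
  refine ⟨e₃, he₃, hs₃.trans (hs₂.trans hs₁), ?_⟩
  rcases hP _ _ _ hs₃ h₂ with h | h
  · exact Or.inr fun x hx ⟨z, hz⟩ => h hx ⟨z, rfl, hz⟩
  refine Or.inl fun x hx => ?_
  have hmem : ∀ k, x k ∈ range e₃ := fun k => hx.2.2 k (Nat.zero_le _)
  have hnot : ∀ s k, Q x s k →
      ¬ Accepts (N s) (initSeg x (k + 1)) (nodesAbove (range e₃) (x k)) := by
    intro s k hQ
    obtain ⟨e, he, hs⟩ := he₃.exists_subset_nodesAbove (hmem k)
    exact (hQ.2.mono (nodesAbove_mono (hs₃.trans hs₂) _)).not_accepts he hs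
  obtain ⟨n₀, k₀, -, hQ₀⟩ := h hx
  obtain ⟨z, hz⟩ := exists_initSeg_of_step (Q := fun s k => Q x (n₀ :: s) k) hQ₀ (by
    intro s k hQ
    obtain ⟨n, k', hk', hQ'⟩ := (h₃ _ (hmem k) (initSeg x (k + 1), n₀ :: s)
      ⟨hx.1.initSeg_mem_stems k, hQ.1⟩).resolve_left (hnot _ _ hQ)
      (mem_cyl_initSeg hx (Nat.zero_le k))
    exact ⟨n, k', by simpa using hk', hQ'⟩)
  let w : ℕ → ℕ := fun i => Nat.casesOn i n₀ z
  refine ⟨w, funext fun t => ?_⟩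
  obtain ⟨j, hj⟩ : ∃ j, ∀ z', initSeg z' j = initSeg w j → f z' t = f w t := by
    have hopen : IsOpen {z' | f z' t = f w t} :=
      (isOpen_discrete {f w t}).preimage ((continuous_apply t).comp hf)
    obtain ⟨_, ⟨v, j, rfl⟩, hwv, hsub⟩ :=
      (PiNat.isTopologicalBasis_cylinders fun _ : ℕ => ℕ).exists_subset_of_mem_open
        (show w ∈ {z' | f z' t = f w t} from rfl) hopen
    refine ⟨j, fun z' hz' => hsub fun i hi => ?_⟩
    rw [initSeg_eq_initSeg.1 hz' i hi, hwv i hi]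
  obtain ⟨k, hk, hQ⟩ := hz (max j t.length)
  obtain ⟨y, hy, hyN⟩ := not_subset.1 (hnot _ _ hQ)
  obtain ⟨z', hz', hfz'⟩ := not_not.1 hyN
  have hw : n₀ :: initSeg z (max j t.length) = initSeg w (max j t.length + 1) := by
    simp [initSeg, List.range_succ_eq_map, w]
  rw [hw, length_initSeg, initSeg_eq_initSeg] at hz'
  have hyx := hy.2.1
  rw [length_initSeg, initSeg_eq_initSeg] at hyx
  rw [← hj z' (initSeg_eq_initSeg.2 fun i hi => hz' i (by omega)), hfz']
  exact hx.1.rangeIndicator_congr hy.1 hyx (by omega)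

/-- **Stern's partition theorem.** Let `D` be a dyadic subtree of
`2^{<ℕ}` and let `𝒳` be an analytic subset of `[D]_chains` (inside the Cantor
space of all subsets of `2^{<ℕ}`).  Then there exists a dyadic subtree `S ⊆ D`
with `[S]_chains ⊆ 𝒳` or `[S]_chains ∩ 𝒳 = ∅`. -/
theorem stmt_16 (d : List Bool → List Bool) (hd : IsDyadicSubtree d)
    (𝒳 : Set (List Bool → Bool))
    (h𝒳sub : 𝒳 ⊆ InfiniteChains (Set.range d))
    (h𝒳an : MeasureTheory.AnalyticSet 𝒳) :
    ∃ s : List Bool → List Bool, IsDyadicSubtree s ∧ Set.range s ⊆ Set.range d ∧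
      (InfiniteChains (Set.range s) ⊆ 𝒳 ∨ InfiniteChains (Set.range s) ∩ 𝒳 = ∅) := by
  rw [MeasureTheory.AnalyticSet] at h𝒳an
  rcases h𝒳an with rfl | ⟨f, hf, rfl⟩
  · exact ⟨d, hd, Set.Subset.rfl, Or.inr (Set.inter_empty _)⟩
  obtain ⟨e, he, hs, h⟩ := hd.isBranching.exists_mem_range_or_notMem_range hf
  refine ⟨e, he.isDyadicSubtree, hs, h.imp (fun h χ hχ => ?_) fun h => ?_⟩
  · obtain ⟨x, hx, hxe, rfl⟩ := exists_isChainSeq hχ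
    exact h x ⟨hx, rfl, fun n _ => hxe n⟩
  · refine Set.eq_empty_of_forall_notMem fun χ ⟨hχ, hχf⟩ => ?_
    obtain ⟨x, hx, hxe, rfl⟩ := exists_isChainSeq hχ
    exact h x ⟨hx, rfl, fun n _ => hxe n⟩ hχf
end
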